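/- arXiv:2508.18323 — 7 statements merged into one kernel-verified Lean document; each statement's English description precedes it below -/
import Mathlib

section
/- Let R be a commutative ring and M an R-module equipped with a bilinear form B : M × M → R satisfying B(x,x) = 0 for all x ∈ M. Then the symplectic quandle operation x ▷ y = x + B(x,y)·y is right self-distributive: for all x, y, z ∈ M, (x ▷ y) ▷ z = (x ▷ z) ▷ (y ▷ z). -/
/-- The symplectic quandle operation `x ▷ y = x + B(x,y) • y`. -/
def symOp {R : Type*} [CommRing R] {M : Type*} [AddCommGroup M] [Module R M]
    (B : M →ₗ[R] M →ₗ[R] R) (x y : M) : M :=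
  x + B x y • y

/-- the symplectic quandle operation is right self-distributive. -/
theorem symplectic_quandle_right_distributive
    (R : Type*) [CommRing R] (M : Type*) [AddCommGroup M] [Module R M]
    (B : M →ₗ[R] M →ₗ[R] R) (hAlt : ∀ x : M, B x x = 0) :
    ∀ x y z : M, symOp B (symOp B x y) z = symOp B (symOp B x z) (symOp B y z) := by
  intro x y z
  have hzy : B z y = -B y z := by
    rw [LinearMap.IsAlt.neg (B := B) hAlt y z]
  have hpres : B (x + B x z • z) (y + B y z • z) = B x y := by
    simp only [map_add, map_smul, LinearMap.add_apply, LinearMap.smul_apply, smul_eq_mul,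
      hAlt z, hzy]
    ring
  simp only [symOp]
  rw [hpres]
  simp only [map_add, map_smul, LinearMap.add_apply, LinearMap.smul_apply, smul_eq_mul]
  module
end

section
/- Let R be a commutative ring and M an R-module equipped with a bilinear form B : M × M → R satisfying B(x,x) = 0 for all x ∈ M. Then M with the operation x ▷ y = x + B(x,y)·y is a quandle: the operation is idempotent, for each y the map x ↦ x ▷ y is bijective, and the operation is right self-distributive. -/
/-- Right translation by `z` preserves the alternating form `B`. -/
theorem bilin_symOp_symOp {R : Type*} [CommRing R] {M : Type*} [AddCommGroup M] [Module R M]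
    (B : M →ₗ[R] M →ₗ[R] R) (hB : B.IsAlt) (x y z : M) :
    B (symOp B x z) (symOp B y z) = B x y := by
  simp only [symOp, map_add, map_smul, LinearMap.add_apply, LinearMap.smul_apply, smul_eq_mul,
    hB.self_eq_zero z, ← hB.neg y z]
  ring

/-- `(M, ▷)` is a quandle: idempotent, right translations are bijective,
and right self-distributive. -/
theorem symplectic_quandle_is_quandle
    (R : Type*) [CommRing R] (M : Type*) [AddCommGroup M] [Module R M]
    (B : M →ₗ[R] M →ₗ[R] R) (hAlt : ∀ x : M, B x x = 0) :
    (∀ x : M, symOp B x x = x) ∧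
      (∀ y : M, Function.Bijective fun x : M => symOp B x y) ∧
      (∀ x y z : M, symOp B (symOp B x y) z = symOp B (symOp B x z) (symOp B y z)) := by
  refine ⟨fun x => by simp [symOp, hAlt], fun y => ?_, fun x y z => ?_⟩
  · refine Function.bijective_iff_has_inverse.mpr
      ⟨fun x => x - B x y • y, fun x => ?_, fun x => ?_⟩ <;> simp [symOp, hAlt]
  · rw [symOp.eq_1 B (symOp B x z), bilin_symOp_symOp B hAlt]
    simp only [symOp, map_add, map_smul, LinearMap.add_apply, LinearMap.smul_apply, smul_eq_mul]
    module
end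

section
/- Let B be the bilinear form on (ℤ/3ℤ)² given by B(x,y) = xᵀ J' y where J' is the matrix with rows (0, 2) and (1, 0) (i.e. 2J modulo 3), and let x ▷ y = x + B(x,y)·y be the symplectic quandle operation. Then the number of quadruples (l, m₁, m₂, r) ∈ ((ℤ/3ℤ)²)⁴ satisfying the four crossing relations l = l ▷ m₁, m₂ = m₁ ▷ l, m₁ = m₂ ▷ r, and r = r ▷ m₂ is exactly 153. -/
open Matrix

/-- The bilinear form `B(x,y) = xᵀ J' y` on `(ℤ/3ℤ)²`, where `J' = !![0, 2; 1, 0]`. -/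
def B3 (x y : Fin 2 → ZMod 3) : ZMod 3 :=
  x ⬝ᵥ ((!![0, 2; 1, 0] : Matrix (Fin 2) (Fin 2) (ZMod 3)).mulVec y)

/-- The symplectic quandle operation `x ▷ y = x + B(x,y) • y` on `(ℤ/3ℤ)²`. -/
def op3 (x y : Fin 2 → ZMod 3) : Fin 2 → ZMod 3 :=
  x + B3 x y • y

theorem B3_eq (x y : Fin 2 → ZMod 3) : B3 x y = x 1 * y 0 - x 0 * y 1 := by
  have h : (2 : ZMod 3) = -1 := by decide
  simp [B3, dotProduct, mulVec, Fin.sum_univ_two, h]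
  ring

theorem B3_swap (x y : Fin 2 → ZMod 3) : B3 y x = -B3 x y := by
  rw [B3_eq, B3_eq]
  ring

theorem eq_op3_iff (x y : Fin 2 → ZMod 3) : x = op3 x y ↔ B3 x y = 0 ∨ y = 0 := by
  rw [op3, left_eq_add, smul_eq_zero]

/-- If acting by `y` fixes `x`, then acting by `x` fixes `y`. -/
theorem op3_eq_of_eq_op3 {x y : Fin 2 → ZMod 3} (h : x = op3 x y) : op3 y x = y := by
  rcases (eq_op3_iff x y).1 h with h | rfl
  · simp [op3, B3_swap x y, h]
  · simp [op3, B3_eq]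

theorem coloring_relations_iff (l m₁ m₂ r : Fin 2 → ZMod 3) :
    (l = op3 l m₁ ∧ m₂ = op3 m₁ l ∧ m₁ = op3 m₂ r ∧ r = op3 r m₂) ↔
      m₂ = m₁ ∧ l = op3 l m₁ ∧ r = op3 r m₁ := by
  constructor
  · rintro ⟨hl, hm, -, hr⟩
    rw [op3_eq_of_eq_op3 hl] at hm
    subst hm
    exact ⟨rfl, hl, hr⟩
  · rintro ⟨rfl, hl, hr⟩
    exact ⟨hl, (op3_eq_of_eq_op3 hl).symm, (op3_eq_of_eq_op3 hr).symm, hr⟩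

/-- A coloring amounts to a color `m` of the middle component together with
two colors fixed by `m`. -/
def coloringEquiv :
    {c : (Fin 2 → ZMod 3) × (Fin 2 → ZMod 3) × (Fin 2 → ZMod 3) × (Fin 2 → ZMod 3) //
      c.1 = op3 c.1 c.2.1 ∧ c.2.2.1 = op3 c.2.1 c.1 ∧
      c.2.1 = op3 c.2.2.1 c.2.2.2 ∧ c.2.2.2 = op3 c.2.2.2 c.2.2.1} ≃
    Σ m : Fin 2 → ZMod 3, {x // x = op3 x m} × {x // x = op3 x m} where
  toFun c := ⟨c.1.2.1, ⟨c.1.1, c.2.1⟩,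
    ⟨c.1.2.2.2, ((coloring_relations_iff _ _ _ _).1 c.2).2.2⟩⟩
  invFun s := ⟨(s.2.1, s.1, s.1, s.2.2),
    (coloring_relations_iff _ _ _ _).2 ⟨rfl, s.2.1.2, s.2.2.2⟩⟩
  left_inv := by
    rintro ⟨⟨l, m₁, m₂, r⟩, h⟩
    obtain ⟨rfl, -, -⟩ := (coloring_relations_iff l m₁ m₂ r).1 h
    rfl
  right_inv _ := rfl

theorem card_fixed (m : Fin 2 → ZMod 3) :
    Fintype.card {x // x = op3 x m} = if m = 0 then 9 else 3 := by
  rw [Fintype.card_congr (Equiv.subtypeEquivRight fun x => by rw [eq_op3_iff, B3_eq])]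
  revert m
  decide

/-- the number of colorings of the connected sum of two Hopf links
by the symplectic quandle on `(ℤ/3ℤ)²` with form `J' = 2J mod 3` is `153`. -/
theorem hopf_connected_sum_count_Z3 :
    Fintype.card {c : (Fin 2 → ZMod 3) × (Fin 2 → ZMod 3) × (Fin 2 → ZMod 3) × (Fin 2 → ZMod 3) //
      c.1 = op3 c.1 c.2.1 ∧ c.2.2.1 = op3 c.2.1 c.1 ∧
      c.2.1 = op3 c.2.2.1 c.2.2.2 ∧ c.2.2.2 = op3 c.2.2.2 c.2.2.1} = 153 := by
  rw [Fintype.card_congr coloringEquiv, Fintype.card_sigma]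
  simp only [Fintype.card_prod, card_fixed]
  decide
end

section
/- Let F be a field and B a nondegenerate alternating bilinear form on F² (B(x,x) = 0 for all x, and B(x,y) = 0 for all y implies x = 0), with symplectic quandle operation x ▷ y = x + B(x,y)·y. Then every quadruple (l, m₁, m₂, r) ∈ (F²)⁴ satisfying the relations l = l ▷ m₁, m₂ = m₁ ▷ l, m₁ = m₂ ▷ r, and r = r ▷ m₂ has m₁ = m₂; consequently the set of values {l, m₁, m₂, r} of any such coloring has at most 3 elements. -/
/-- for any nondegenerate alternating bilinear form `B` on `F²` with
symplectic quandle operation `x ▷ y = x + B(x,y) • y`, every coloring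
`(l, m₁, m₂, r)` of the connected sum of two Hopf links satisfies `m₁ = m₂`, and
hence its image `{l, m₁, m₂, r}` has at most 3 elements. -/
theorem hopf_connected_sum_coloring_middle_arcs_eq
    (F : Type*) [Field F]
    (B : (Fin 2 → F) →ₗ[F] (Fin 2 → F) →ₗ[F] F)
    (hAlt : ∀ x : Fin 2 → F, B x x = 0)
    (hNondeg : ∀ x : Fin 2 → F, (∀ y : Fin 2 → F, B x y = 0) → x = 0) :
    ∀ l m₁ m₂ r : Fin 2 → F,
      l = l + B l m₁ • m₁ →
      m₂ = m₁ + B m₁ l • l →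
      m₁ = m₂ + B m₂ r • r →
      r = r + B r m₂ • m₂ →
      m₁ = m₂ ∧ ({l, m₁, m₂, r} : Set (Fin 2 → F)).ncard ≤ 3 := by
  intro l m₁ m₂ r hl hm _ _
  have hlm : B l m₁ = 0 := by
    rcases smul_eq_zero.mp (left_eq_add.mp hl) with h | h
    · exact h
    · rw [h, map_zero]
  have hml : B m₁ l = 0 := LinearMap.IsAlt.isRefl hAlt l m₁ hlm
  obtain rfl : m₂ = m₁ := by rw [hm, hml, zero_smul, add_zero]
  refine ⟨rfl, ?_⟩
  classical
  rw [Set.insert_eq_of_mem (Set.mem_insert m₂ {r})]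
  simpa [← Set.ncard_coe_finset] using Finset.card_le_three (a := l) (b := m₂) (c := r)
end

section
/- Let B be the bilinear form on (ℤ/3ℤ)² given by B(x,y) = xᵀ J' y where J' has rows (0, 2) and (1, 0), with symplectic quandle operation x ▷ y = x + B(x,y)·y. Among the quadruples (l, m₁, m₂, r) ∈ ((ℤ/3ℤ)²)⁴ satisfying l = l ▷ m₁, m₂ = m₁ ▷ l, m₁ = m₂ ▷ r, r = r ▷ m₂, exactly 9 have image {l, m₁, m₂, r} of cardinality 1, exactly 72 have image of cardinality 2, exactly 72 have image of cardinality 3, and none has image of cardinality greater than 3 (i.e. the enhanced quandle counting polynomial of H over this quandle is 9q + 72q² + 72q³). -/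
open Matrix

/-- The four crossing relations of the connected sum of two Hopf links for the
quadruple of arc colors `(l, m₁, m₂, r)`. -/
def rel3 (c : (Fin 2 → ZMod 3) × (Fin 2 → ZMod 3) × (Fin 2 → ZMod 3) × (Fin 2 → ZMod 3)) :
    Prop :=
  c.1 = op3 c.1 c.2.1 ∧ c.2.2.1 = op3 c.2.1 c.1 ∧
    c.2.1 = op3 c.2.2.1 c.2.2.2 ∧ c.2.2.2 = op3 c.2.2.2 c.2.2.1

instance : DecidablePred rel3 := fun c => by unfold rel3; infer_instance

/-- The image of a coloring: the set of colors `{l, m₁, m₂, r}` used on the arcs. -/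
def img3 (c : (Fin 2 → ZMod 3) × (Fin 2 → ZMod 3) × (Fin 2 → ZMod 3) × (Fin 2 → ZMod 3)) :
    Finset (Fin 2 → ZMod 3) :=
  {c.1, c.2.1, c.2.2.1, c.2.2.2}

theorem eq_op3_self_iff (x y : Fin 2 → ZMod 3) : x = op3 x y ↔ B3 x y = 0 := by
  revert x y
  decide +kernel

theorem B3_comm_eq_zero (x y : Fin 2 → ZMod 3) : B3 x y = 0 ↔ B3 y x = 0 := by
  revert x y
  decide +kernel

theorem rel3_iff (l m₁ m₂ r : Fin 2 → ZMod 3) :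
    rel3 (l, m₁, m₂, r) ↔ m₂ = m₁ ∧ B3 l m₁ = 0 ∧ B3 m₁ r = 0 := by
  simp only [rel3, eq_op3_self_iff]
  constructor
  · rintro ⟨hl, hm, -, hr⟩
    have h : m₂ = m₁ := by rw [hm, op3, (B3_comm_eq_zero l m₁).1 hl, zero_smul, add_zero]
    subst h
    exact ⟨rfl, hl, (B3_comm_eq_zero r m₂).1 hr⟩
  · rintro ⟨rfl, hl, hr⟩
    exact ⟨hl, (eq_op3_self_iff _ _).2 ((B3_comm_eq_zero _ _).1 hl),
      (eq_op3_self_iff _ _).2 hr, (B3_comm_eq_zero _ _).1 hr⟩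

/-- Colorings correspond to triples `(l, m, r)` with `B(l, m) = B(m, r) = 0`. -/
theorem card_colorings (k : ℕ) :
    (Finset.univ.filter (fun c => rel3 c ∧ (img3 c).card = k)).card =
      (Finset.univ.filter (fun t : (Fin 2 → ZMod 3) × (Fin 2 → ZMod 3) × (Fin 2 → ZMod 3) =>
        (B3 t.1 t.2.1 = 0 ∧ B3 t.2.1 t.2.2 = 0) ∧
          ({t.1, t.2.1, t.2.2} : Finset (Fin 2 → ZMod 3)).card = k)).card := by
  symm
  refine Finset.card_bij (fun t _ => (t.1, t.2.1, t.2.1, t.2.2)) ?_ ?_ ?_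
  · rintro ⟨l, m, r⟩ h
    rw [Finset.mem_filter] at h ⊢
    simpa [rel3_iff, img3] using h
  · rintro ⟨l, m, r⟩ - ⟨l', m', r'⟩ - h
    simp_all
  · rintro ⟨l, m₁, m₂, r⟩ h
    simp only [Finset.mem_filter, Finset.mem_univ, true_and, rel3_iff] at h
    obtain ⟨⟨rfl, h⟩, hk⟩ := h
    exact ⟨(l, m₂, r), by simpa [img3, h] using hk, rfl⟩

/-- the enhanced quandle counting polynomial of the connected sum of
two Hopf links over the symplectic quandle on `(ℤ/3ℤ)²` with form `J' = 2J mod 3`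
is `9q + 72q² + 72q³`: 9 colorings of image size 1, 72 of image size 2, 72 of image
size 3, and none of image size greater than 3. -/
theorem hopf_connected_sum_enhanced_Z3 :
    (Finset.univ.filter (fun c => rel3 c ∧ (img3 c).card = 1)).card = 9 ∧
    (Finset.univ.filter (fun c => rel3 c ∧ (img3 c).card = 2)).card = 72 ∧
    (Finset.univ.filter (fun c => rel3 c ∧ (img3 c).card = 3)).card = 72 ∧
    (∀ c, rel3 c → (img3 c).card ≤ 3) := by
  refine ⟨?_, ?_, ?_, ?_⟩
  · rw [card_colorings]
    decide +kernel
  · rw [card_colorings]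
    decide +kernel
  · rw [card_colorings]
    decide +kernel
  · rintro ⟨l, m₁, m₂, r⟩ h
    obtain ⟨rfl, -⟩ := (rel3_iff l m₁ m₂ r).1 h
    simpa [img3] using Finset.card_le_three (a := l) (b := m₂) (c := r)
end

section
/- Let B be the bilinear form on (ℤ/5ℤ)² given by B(x,y) = xᵀ J y where J has rows (0, 1) and (−1, 0), with symplectic quandle operation x ▷ y = x + B(x,y)·y. Then the number of quadruples (l, m₁, m₂, r) ∈ ((ℤ/5ℤ)²)⁴ satisfying the four crossing relations l = l ▷ m₁, m₂ = m₁ ▷ l, m₁ = m₂ ▷ r, and r = r ▷ m₂ is exactly 1225. -/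
open Matrix

/-- The bilinear form `B(x,y) = xᵀ J' y` on `(ℤ/5ℤ)²`, where `J' = !![0, 1; -1, 0]`. -/
def B5 (x y : Fin 2 → ZMod 5) : ZMod 5 :=
  x ⬝ᵥ ((!![0, 1; -1, 0] : Matrix (Fin 2) (Fin 2) (ZMod 5)).mulVec y)

/-- The symplectic quandle operation `x ▷ y = x + B(x,y) • y` on `(ℤ/5ℤ)²`. -/
def op5 (x y : Fin 2 → ZMod 5) : Fin 2 → ZMod 5 :=
  x + B5 x y • y

theorem B5_eq (x y : Fin 2 → ZMod 5) : B5 x y = x 0 * y 1 - x 1 * y 0 := by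
  simp [B5, Matrix.mulVec, dotProduct, Fin.sum_univ_two]
  ring

theorem B5_swap (x y : Fin 2 → ZMod 5) : B5 y x = -B5 x y := by
  rw [B5_eq, B5_eq]
  ring

theorem B5_zero_right (x : Fin 2 → ZMod 5) : B5 x 0 = 0 := by
  simp [B5_eq]

instance : Fact (Nat.Prime 5) := ⟨by norm_num⟩

theorem eq_op5_self_iff (x y : Fin 2 → ZMod 5) : x = op5 x y ↔ B5 x y = 0 := by
  rw [op5, left_eq_add, smul_eq_zero, or_iff_left_iff_imp]
  rintro rfl
  exact B5_zero_right x

theorem hopf_connected_sum_coloring_iff (l m₁ m₂ r : Fin 2 → ZMod 5) :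
    (l = op5 l m₁ ∧ m₂ = op5 m₁ l ∧ m₁ = op5 m₂ r ∧ r = op5 r m₂) ↔
      m₂ = m₁ ∧ B5 l m₁ = 0 ∧ B5 r m₁ = 0 := by
  constructor
  · rintro ⟨hl, hm, -, hr⟩
    rw [eq_op5_self_iff] at hl hr
    obtain rfl : m₂ = m₁ := by simpa [op5, B5_swap l m₁, hl] using hm
    exact ⟨rfl, hl, hr⟩
  · rintro ⟨rfl, hl, hr⟩
    refine ⟨(eq_op5_self_iff _ _).2 hl, (eq_op5_self_iff _ _).2 ?_,
      (eq_op5_self_iff _ _).2 ?_, (eq_op5_self_iff _ _).2 hr⟩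
    · rw [B5_swap, hl, neg_zero]
    · rw [B5_swap, hr, neg_zero]

/-- Colorings correspond to a color of the middle component together with two colors
orthogonal to it. -/
def hopfConnectedSumColoringEquiv :
    {c : (Fin 2 → ZMod 5) × (Fin 2 → ZMod 5) × (Fin 2 → ZMod 5) × (Fin 2 → ZMod 5) //
      c.1 = op5 c.1 c.2.1 ∧ c.2.2.1 = op5 c.2.1 c.1 ∧
      c.2.1 = op5 c.2.2.1 c.2.2.2 ∧ c.2.2.2 = op5 c.2.2.2 c.2.2.1} ≃
    Σ m : Fin 2 → ZMod 5, {x // B5 x m = 0} × {x // B5 x m = 0} where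
  toFun c :=
    have h := (hopf_connected_sum_coloring_iff _ _ _ _).1 c.2
    ⟨c.1.2.1, ⟨c.1.1, h.2.1⟩, ⟨c.1.2.2.2, h.2.2⟩⟩
  invFun s := ⟨(s.2.1, s.1, s.1, s.2.2),
    (hopf_connected_sum_coloring_iff _ _ _ _).2 ⟨rfl, s.2.1.2, s.2.2.2⟩⟩
  left_inv := by
    rintro ⟨⟨l, m₁, m₂, r⟩, h⟩
    obtain ⟨rfl, -, -⟩ := (hopf_connected_sum_coloring_iff l m₁ m₂ r).1 h
    rfl
  right_inv _ := rfl

theorem sum_sq_card_orthogonal_pairs :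
    ∑ m : ZMod 5 × ZMod 5,
      Fintype.card {x : ZMod 5 × ZMod 5 // x.1 * m.2 - x.2 * m.1 = 0} ^ 2 = 1225 := by
  decide +kernel

theorem card_orthogonal (m : Fin 2 → ZMod 5) :
    Fintype.card {x // B5 x m = 0} =
      Fintype.card {x : ZMod 5 × ZMod 5 // x.1 * m 1 - x.2 * m 0 = 0} :=
  Fintype.card_congr ((finTwoArrowEquiv (ZMod 5)).subtypeEquiv fun x => by
    rw [B5_eq]
    rfl)

/-- the number of colorings of the connected sum of two Hopf links
by the symplectic quandle on `(ℤ/5ℤ)²` with form `J` is `1225`. -/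
theorem hopf_connected_sum_count_Z5 :
    Fintype.card {c : (Fin 2 → ZMod 5) × (Fin 2 → ZMod 5) × (Fin 2 → ZMod 5) × (Fin 2 → ZMod 5) //
      c.1 = op5 c.1 c.2.1 ∧ c.2.2.1 = op5 c.2.1 c.1 ∧
      c.2.1 = op5 c.2.2.1 c.2.2.2 ∧ c.2.2.2 = op5 c.2.2.2 c.2.2.1} = 1225 := by
  rw [Fintype.card_congr hopfConnectedSumColoringEquiv, Fintype.card_sigma,
    ← sum_sq_card_orthogonal_pairs]
  refine Fintype.sum_equiv (finTwoArrowEquiv (ZMod 5)) _ _ fun m => ?_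
  rw [Fintype.card_prod, card_orthogonal, sq]
  rfl
end

section
/- Let p be a prime and let B be the bilinear form on (ℤ/pℤ)² given by B(x,y) = xᵀ J y where J has rows (0, 1) and (−1, 0), with symplectic quandle operation x ▷ y = x + B(x,y)·y. Then there exists a quadruple (l, m₁, m₂, r) ∈ ((ℤ/pℤ)²)⁴ satisfying the four relations l = l ▷ m₁, m₂ = m₁ ▷ l, m₁ = m₂ ▷ r, r = r ▷ m₂ whose image {l, m₁, m₂, r} has exactly 3 elements; combined with the bound that every such coloring has image of size at most 3, the enhanced quandle counting polynomial of H over this quandle has degree exactly 3. -/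
open Matrix

/-- The symplectic quandle operation `x ▷ y = x + (xᵀ J y) • y` on `(ℤ/pℤ)²`,
where `J = !![0, 1; -1, 0]`. -/
def opP (p : ℕ) (x y : Fin 2 → ZMod p) : Fin 2 → ZMod p :=
  x + (x ⬝ᵥ ((!![0, 1; -1, 0] : Matrix (Fin 2) (Fin 2) (ZMod p)).mulVec y)) • y

theorem opP_apply (p : ℕ) (x y : Fin 2 → ZMod p) (i : Fin 2) :
    opP p x y i = x i + (x 0 * y 1 - x 1 * y 0) * y i := by
  simp [opP, dotProduct, mulVec, Fin.sum_univ_two, sub_eq_add_neg]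

theorem opP_zero_right (p : ℕ) (x : Fin 2 → ZMod p) : opP p x 0 = x := by
  simp [opP]

theorem opP_zero_left (p : ℕ) (y : Fin 2 → ZMod p) : opP p 0 y = 0 := by
  simp [opP]

/-- Acting trivially is a symmetric relation in the symplectic quandle. -/
theorem opP_eq_self_symm (p : ℕ) [Fact p.Prime] {x y : Fin 2 → ZMod p}
    (h : x = opP p x y) : opP p y x = y := by
  have hy : ∀ i, (x 0 * y 1 - x 1 * y 0) * y i = 0 := fun i => by
    simpa [opP_apply] using congrFun h i
  have hB : x 0 * y 1 - x 1 * y 0 = 0 := by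
    by_contra hne
    have hy0 := (mul_eq_zero.mp (hy 0)).resolve_left hne
    have hy1 := (mul_eq_zero.mp (hy 1)).resolve_left hne
    exact hne (by simp [hy0, hy1])
  ext i
  rw [opP_apply]
  linear_combination (-x i) * hB

/-- for every prime `p`, the connected sum of two Hopf links has a
coloring by the symplectic quandle on `(ℤ/pℤ)²` whose image has exactly 3 elements,
while every coloring has image of size at most 3; hence the enhanced quandle
counting polynomial has degree exactly 3. -/
theorem hopf_connected_sum_enhanced_degree_three (p : ℕ) [Fact p.Prime] :
    (∃ l m₁ m₂ r : Fin 2 → ZMod p,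
      (l = opP p l m₁ ∧ m₂ = opP p m₁ l ∧ m₁ = opP p m₂ r ∧ r = opP p r m₂) ∧
        ({l, m₁, m₂, r} : Finset (Fin 2 → ZMod p)).card = 3) ∧
    (∀ l m₁ m₂ r : Fin 2 → ZMod p,
      (l = opP p l m₁ ∧ m₂ = opP p m₁ l ∧ m₁ = opP p m₂ r ∧ r = opP p r m₂) →
        ({l, m₁, m₂, r} : Finset (Fin 2 → ZMod p)).card ≤ 3) := by
  constructor
  · refine ⟨![1, 0], 0, 0, ![0, 1], ?_, ?_⟩
    · simp [opP_zero_right, opP_zero_left]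
    · have hl : (![1, 0] : Fin 2 → ZMod p) ≠ 0 := fun h => by simpa using congrFun h 0
      have hr : (0 : Fin 2 → ZMod p) ≠ ![0, 1] := fun h => by simpa using congrFun h 1
      have hlr : (![1, 0] : Fin 2 → ZMod p) ≠ ![0, 1] := fun h => by simpa using congrFun h 0
      rw [Finset.insert_eq_of_mem (a := (0 : Fin 2 → ZMod p)) (Finset.mem_insert_self _ _)]
      exact Finset.card_eq_three.mpr ⟨_, _, _, hl, hlr, hr, rfl⟩
  · rintro l m₁ m₂ r ⟨hl, hm, -, -⟩
    obtain rfl : m₂ = m₁ := hm.trans (opP_eq_self_symm p hl)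
    rw [Finset.insert_eq_of_mem (a := m₂) (Finset.mem_insert_self _ _)]
    exact Finset.card_le_three
end
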